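/- arXiv:1509.01601 — 3 statements merged into one kernel-verified Lean document; each statement's English description precedes it below -/
import Mathlib

section
/- For every non-compact, crowded, separable metrizable space X, the minimal character of a far closed set equals 𝔡: X has a far closed set of character 𝔡 in βX, and every far closed set of X has character at least 𝔡. -/
open Set Topology

/-- A subset `D` is discrete if each of its points has an open neighborhood
meeting `D` only in that point. -/
def IsDiscreteSubset {X : Type*} [TopologicalSpace X] (D : Set X) : Prop :=
  ∀ x ∈ D, ∃ U : Set X, IsOpen U ∧ x ∈ U ∧ U ∩ D = {x}

/-- A space is countably tight if every point in the closure of a set is in the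
closure of a countable subset of it. -/
def CountablyTight (X : Type*) [TopologicalSpace X] : Prop :=
  ∀ (A : Set X) (x : X), x ∈ closure A → ∃ C ⊆ A, C.Countable ∧ x ∈ closure C
/-- The dominating number 𝔡 : the least cardinality of a family G ⊆ ω^ω such that
every f ∈ ω^ω is eventually dominated by some member of G. -/
noncomputable def dominatingNumber : Cardinal :=
  sInf { c | ∃ G : Set (ℕ → ℕ), Cardinal.mk G = c ∧
    ∀ f : ℕ → ℕ, ∃ g ∈ G, {n : ℕ | g n < f n}.Finite }
/-- A set `F ⊆ βX` is far from `X` if it misses the closure (in `βX`) of the image of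
every closed discrete subset of `X`. -/
def IsFarSet {X : Type*} [TopologicalSpace X] (F : Set (StoneCech X)) : Prop :=
  ∀ D : Set X, IsClosed D → IsDiscreteSubset D →
    F ∩ closure (stoneCechUnit '' D) = ∅

/-- A set `F ⊆ βX` is remote from `X` if it misses the closure (in `βX`) of the image of
every nowhere dense subset of `X`. -/
def IsRemoteSet {X : Type*} [TopologicalSpace X] (F : Set (StoneCech X)) : Prop :=
  ∀ N : Set X, IsNowhereDense N → F ∩ closure (stoneCechUnit '' N) = ∅
/-- The character of a closed set `F`: the least cardinality of a family of open sets
containing `F` such that every open set containing `F` contains a member of the family. -/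
noncomputable def setChar {Z : Type*} [TopologicalSpace Z] (F : Set Z) : Cardinal :=
  sInf { c | ∃ B : Set (Set Z), Cardinal.mk B = c ∧ (∀ U ∈ B, IsOpen U ∧ F ⊆ U) ∧
    ∀ V : Set Z, IsOpen V → F ⊆ V → ∃ U ∈ B, U ⊆ V }

theorem sc_disjoint {X : Type} [TopologicalSpace X] [NormalSpace X] {A B : Set X}
    (hA : IsClosed A) (hB : IsClosed B) (h : Disjoint A B) :
    Disjoint (closure (stoneCechUnit '' A)) (closure (stoneCechUnit '' B)) := by
  obtain ⟨f, hf0, hf1, hf⟩ := exists_continuous_zero_one_of_isClosed hA hB h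
  let g : X → Icc (0:ℝ) 1 := fun x => ⟨f x, hf x⟩
  have hg : Continuous g := by fun_prop
  have hc := continuous_stoneCechExtend hg
  have e : ∀ x, stoneCechExtend hg (stoneCechUnit x) = g x := fun x =>
    congrFun (stoneCechExtend_extends hg) x
  have key : ∀ (S : Set X) (c : Icc (0:ℝ) 1), (∀ x ∈ S, g x = c) →
      closure (stoneCechUnit '' S) ⊆ stoneCechExtend hg ⁻¹' {c} := by
    intro S c hS
    refine closure_minimal ?_ (isClosed_singleton.preimage hc)
    rintro _ ⟨x, hx, rfl⟩
    simp [e, hS x hx]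
  rw [Set.disjoint_left]
  intro z hz hz'
  have h0 := key A 0 (fun x hx => Subtype.ext (hf0 hx)) hz
  have h1 := key B 1 (fun x hx => Subtype.ext (hf1 hx)) hz'
  simp only [mem_preimage, mem_singleton_iff] at h0 h1
  rw [h0] at h1
  exact zero_ne_one h1

theorem setChar_le {Z ι : Type} [TopologicalSpace Z] [CompactSpace Z] [Infinite ι]
    (F : Set Z) (c W : ι → Set Z) (hc : ∀ i, IsClosed (c i)) (hW : ∀ i, IsOpen (W i))
    (hWc : ∀ i, W i ⊆ c i) (hF : F = ⋂ i, c i) (hFW : ∀ i, F ⊆ W i) :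
    setChar F ≤ Cardinal.mk ι := by
  let b : Finset ι → Set Z := fun t => ⋂ i ∈ t, W i
  have h1 : setChar F ≤ Cardinal.mk (range b) := by
    apply csInf_le' 
    refine ⟨range b, rfl, ?_, ?_⟩
    · rintro _ ⟨t, rfl⟩
      exact ⟨isOpen_biInter_finset fun i _ => hW i, subset_iInter₂ fun i _ => hFW i⟩
    · intro V hV hFV
      obtain ⟨u, hu⟩ := hV.isClosed_compl.isCompact.elim_finite_subfamily_closed c hc (by
        rw [← hF, ← disjoint_iff_inter_eq_empty]
        exact (disjoint_compl_left_iff_subset).2 hFV)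
      refine ⟨b u, ⟨u, rfl⟩, ?_⟩
      intro z hz
      by_contra hzV
      have : z ∈ Vᶜ ∩ ⋂ i ∈ u, c i := ⟨hzV, by
        simp only [b, mem_iInter] at hz ⊢
        exact fun i hi => hWc i (hz i hi)⟩
      rw [hu] at this
      exact this
  exact h1.trans (Cardinal.mk_range_le.trans (Cardinal.mk_finset_of_infinite ι).le)

theorem dom_exists : ∃ G : Set (ℕ → ℕ), Cardinal.mk G = dominatingNumber ∧
    ∀ f : ℕ → ℕ, ∃ g ∈ G, {n : ℕ | g n < f n}.Finite := by
  apply csInf_mem (s := { c | ∃ G : Set (ℕ → ℕ), Cardinal.mk G = c ∧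
    ∀ f : ℕ → ℕ, ∃ g ∈ G, {n : ℕ | g n < f n}.Finite })
  exact ⟨_, univ, rfl, fun f => ⟨f, mem_univ _, by simp⟩⟩

theorem dom_family : ∃ (ι : Type) (φ : ι → ℕ → ℕ), Infinite ι ∧ Cardinal.mk ι = dominatingNumber ∧
    ∀ f : ℕ → ℕ, ∃ i, ∀ n, f n ≤ φ i n := by
  obtain ⟨G, hG, hd⟩ := dom_exists
  have hinf : Infinite G := by
    by_contra hfin
    rw [not_infinite_iff_finite] at hfin
    have := Fintype.ofFinite G
    obtain ⟨g, hg, hfi⟩ := hd (fun n => (∑ g : G, g.1 n) + 1)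
    have : {n : ℕ | g n < (∑ g : G, g.1 n) + 1} = univ := by
      ext n
      have := Finset.single_le_sum (f := fun g : G => g.1 n) (s := Finset.univ)
        (fun _ _ => Nat.zero_le _) (Finset.mem_univ ⟨g, hg⟩)
      simp only [mem_ofPred_eq, mem_univ, iff_true]
      simp only at this
      omega
    rw [this] at hfi
    exact infinite_univ hfi
  refine ⟨G × ℕ, fun p n => p.1.1 n + p.2, inferInstance, ?_, ?_⟩
  · rw [Cardinal.mk_prod]
    simp only [Cardinal.lift_id, Cardinal.mk_nat]
    rw [Cardinal.mul_aleph0_eq (Cardinal.aleph0_le_mk G), hG]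
  · intro f
    obtain ⟨g, hg, hfi⟩ := hd f
    refine ⟨(⟨g, hg⟩, ∑ n ∈ hfi.toFinset, f n), fun n => ?_⟩
    by_cases hn : g n < f n
    · have := Finset.single_le_sum (f := f) (s := hfi.toFinset)
        (fun _ _ => Nat.zero_le _) (a := n) (by simpa using hn)
      simp only; omega
    · simp only; omega

theorem far_lower {X K : Type} [TopologicalSpace X] [T2Space X]
    [TopologicalSpace.SeparableSpace X] [MetricSpace K] [CompactSpace K]
    (e : X → K) (he : IsEmbedding e)
    (F : Set (StoneCech X)) (hne : F.Nonempty) (hfar : IsFarSet F) :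
    dominatingNumber ≤ setChar F := by
  obtain ⟨z, hz⟩ := hne
  have hec := he.continuous
  let E := stoneCechExtend hec
  have hE : Continuous E := continuous_stoneCechExtend hec
  have hEe : ∀ x, E (stoneCechUnit x) = e x := fun x =>
    congrFun (stoneCechExtend_extends hec) x
  have hdense := denseRange_stoneCechUnit (α := X)
  -- p not in range e
  have hp : ∀ x, e x ≠ E z := by
    intro x hx
    have hzx : stoneCechUnit x ≠ z := by
      rintro rfl
      have := hfar {x} isClosed_singleton (by
        rintro y rfl
        exact ⟨univ, isOpen_univ, mem_univ _, by simp⟩)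
      have h2 : stoneCechUnit x ∈ F ∩ closure (stoneCechUnit '' {x}) :=
        ⟨hz, subset_closure ⟨x, rfl, rfl⟩⟩
      rw [this] at h2
      exact h2
    obtain ⟨O, O', hO, hO', hxO, hzO, hOO⟩ := t2_separation hzx
    have : stoneCechUnit ⁻¹' O ∈ 𝓝 x :=
      (hO.preimage continuous_stoneCechUnit).mem_nhds hxO
    rw [he.nhds_eq_comap] at this
    obtain ⟨N, hN, hNO⟩ := this
    obtain ⟨N', hN'N, hN'o, hxN'⟩ := mem_nhds_iff.1 hN
    obtain ⟨y, hy⟩ := hdense.exists_mem_open (hO'.inter (hN'o.preimage hE))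
      ⟨z, hzO, by simpa [← hx] using hxN'⟩
    have h1 : y ∈ stoneCechUnit ⁻¹' O := hNO (by
      have := hy.2
      simp only [mem_preimage, hEe] at this
      exact hN'N this)
    exact Set.disjoint_left.1 hOO h1 hy.1
  have hX : Nonempty X := by
    obtain ⟨y, -⟩ := hdense.exists_mem_open isOpen_univ ⟨z, mem_univ _⟩
    exact ⟨y⟩
  let q := TopologicalSpace.denseSeq X
  have hq : DenseRange q := TopologicalSpace.denseRange_denseSeq X
  refine le_csInf ⟨_, {U | IsOpen U ∧ F ⊆ U}, rfl, fun U hU => hU,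
    fun V hV hF => ⟨V, ⟨hV, hF⟩, subset_rfl⟩⟩ ?_
  rintro c ⟨B, rfl, hB, hbase⟩
  have hh : ∀ (U : B) (n : ℕ), ∃ i, stoneCechUnit (q i) ∈ U.1 ∧
      dist (e (q i)) (E z) < 1 / ((n:ℝ) + 1) := by
    intro U n
    have ho : IsOpen (U.1 ∩ {w | dist (E w) (E z) < 1 / ((n:ℝ) + 1)}) :=
      (hB U.1 U.2).1.inter (isOpen_lt (by fun_prop) continuous_const)
    obtain ⟨i, hi⟩ := hq.exists_mem_open (ho.preimage continuous_stoneCechUnit)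
      (by
        obtain ⟨y, hy⟩ := hdense.exists_mem_open ho ⟨z, (hB U.1 U.2).2 hz, by
          simp only [mem_ofPred_eq, dist_self]; positivity⟩
        exact ⟨y, hy⟩)
    refine ⟨i, hi.1, ?_⟩
    have := hi.2
    simpa only [mem_ofPred_eq, hEe] using this
  choose h hhU hhd using hh
  refine le_trans (csInf_le' ⟨range h, rfl, ?_⟩) (Cardinal.mk_range_le (f := h))
  intro f
  let Dn : ℕ → Set X := fun n => {x | ∃ i ≤ f n, x = q i ∧ dist (e (q i)) (E z) < 1 / ((n:ℝ) + 1)}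
  have hDfin : ∀ n, (Dn n).Finite := by
    intro n
    refine ((Set.finite_Iic (f n)).image q).subset ?_
    rintro x ⟨i, hi, rfl, -⟩
    exact ⟨i, hi, rfl⟩
  have hlf : ∀ x, ∃ N, IsOpen N ∧ x ∈ N ∧ {n | (Dn n ∩ N).Nonempty}.Finite := by
    intro x
    have hpos : 0 < dist (e x) (E z) := dist_pos.2 (hp x)
    refine ⟨{y | dist (e x) (E z) / 2 < dist (e y) (E z)},
      isOpen_lt continuous_const (by fun_prop), by simp only [mem_ofPred_eq]; linarith, ?_⟩
    obtain ⟨M, hM⟩ := exists_nat_one_div_lt (half_pos hpos)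
    refine (Set.finite_Iio M).subset ?_
    rintro n ⟨y, ⟨i, -, rfl, hi⟩, hy⟩
    simp only [mem_ofPred_eq] at hy
    simp only [mem_Iio]
    by_contra hn
    push Not at hn
    have : 1 / ((n:ℝ) + 1) ≤ 1 / ((M:ℝ) + 1) := by gcongr
    linarith
  have hLF : LocallyFinite Dn := fun x => by
    obtain ⟨N, hN, hx, hf⟩ := hlf x
    exact ⟨N, hN.mem_nhds hx, hf⟩
  have hcl : IsClosed (⋃ n, Dn n) := hLF.isClosed_iUnion fun n => (hDfin n).isClosed
  have hdisc : IsDiscreteSubset (⋃ n, Dn n) := by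
    intro x hx
    obtain ⟨N, hN, hxN, hf⟩ := hlf x
    have hfin : ((⋃ n, Dn n) ∩ N).Finite := by
      refine (hf.biUnion (fun n _ => hDfin n)).subset ?_
      rintro y ⟨hy, hyN⟩
      obtain ⟨n, hn⟩ := mem_iUnion.1 hy
      exact mem_biUnion (show n ∈ {n | (Dn n ∩ N).Nonempty} from ⟨y, hn, hyN⟩) hn
    refine ⟨N \ (((⋃ n, Dn n) ∩ N) \ {x}), hN.sdiff (hfin.subset sdiff_subset).isClosed,
      ⟨hxN, by simp⟩, ?_⟩
    ext y
    simp only [mem_inter_iff, mem_sdiff, mem_singleton_iff]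
    constructor
    · rintro ⟨⟨h1, h2⟩, h3⟩
      by_contra h4
      exact h2 ⟨⟨h3, h1⟩, h4⟩
    · rintro rfl
      exact ⟨⟨hxN, by simp⟩, hx⟩
  have hF := hfar _ hcl hdisc
  obtain ⟨U, hU, hUV⟩ := hbase (closure (stoneCechUnit '' (⋃ n, Dn n)))ᶜ
    isClosed_closure.isOpen_compl (by
      rw [Set.subset_compl_iff_disjoint_right, disjoint_iff_inter_eq_empty]; exact hF)
  refine ⟨h ⟨U, hU⟩, ⟨_, rfl⟩, ?_⟩
  convert Set.finite_empty (α := ℕ)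
  rw [Set.eq_empty_iff_forall_notMem]
  intro n hn
  simp only [mem_ofPred_eq] at hn
  exact hUV (hhU ⟨U, hU⟩ n) (subset_closure ⟨_, mem_iUnion.2 ⟨n, _, hn.le, rfl, hhd ⟨U, hU⟩ n⟩, rfl⟩)

theorem tower {X : Type} [MetricSpace X] (hcrowd : ∀ x : X, ¬ IsOpen ({x} : Set X)) (n : ℕ) :
    ∀ (x : X) (O : Set X), IsOpen O → x ∈ O → ∃ (R : Set X) (S : ℕ → Set X),
      IsCompact R ∧ R ⊆ O ∧ x ∈ R ∧ (∀ i, S i ⊆ R) ∧ (∀ i, IsCompact (S i)) ∧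
      (∀ p, {i | p ∈ S i}.Finite) ∧
      ∀ t : Finset ℕ, t.card ≤ n → ∃ p ∈ R, ∀ i ∈ t, p ∈ S i := by
  induction n with
  | zero =>
    intro x O hO hx
    refine ⟨{x}, fun _ => ∅, isCompact_singleton, by simpa using hx, rfl, by simp, by simp,
      by simp, ?_⟩
    intro t ht
    have : t = ∅ := by simpa using ht
    subst this
    exact ⟨x, rfl, by simp⟩
  | succ n ih =>
    intro x O hO hx
    obtain ⟨ε, hε, hεO⟩ := Metric.isOpen_iff.1 hO x hx
    have step : ∀ r : ℝ, ∃ (y : X) (s : ℝ), 0 < r → 0 < s ∧ s ≤ r / 2 ∧ s < dist y x ∧ dist y x < r := by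
      intro r
      by_cases hr : 0 < r
      · have : ∃ y, y ≠ x ∧ dist y x < r := by
          by_contra hcon
          push Not at hcon
          apply hcrowd x
          convert Metric.isOpen_ball (x := x) (ε := r)
          ext y
          simp only [mem_singleton_iff, Metric.mem_ball]
          constructor
          · rintro rfl; simpa using hr
          · intro h
            by_contra hne
            exact absurd h (not_lt.2 (hcon y hne))
        obtain ⟨y, hy, hyr⟩ := this
        have := dist_pos.2 hy
        exact ⟨y, dist y x / 2, fun _ => ⟨by linarith, by linarith, by linarith, hyr⟩⟩
      · exact ⟨x, 0, fun h => absurd h hr⟩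
    choose y s hs using step
    let r : ℕ → ℝ := fun j => Nat.rec ε (fun _ a => s a) j
    have hr0 : r 0 = ε := rfl
    have hrs : ∀ j, r (j+1) = s (r j) := fun j => rfl
    have hrpos : ∀ j, 0 < r j := by
      intro j
      induction j with
      | zero => exact hε
      | succ j ihj => rw [hrs]; exact (hs _ ihj).1
    have hrhalf : ∀ j, r (j+1) ≤ r j / 2 := fun j => (hs _ (hrpos j)).2.1
    have hranti : Antitone r := antitone_nat_of_succ_le fun j => by
      have := hrhalf j; have := hrpos j; linarith
    have hrle : ∀ j, r j ≤ ε * (1/2)^j := by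
      intro j
      induction j with
      | zero => simp [hr0]
      | succ j ihj => have := hrhalf j; rw [pow_succ]; linarith
    have hrlim : ∀ δ > 0, ∃ j, r j < δ := by
      intro δ hδ
      obtain ⟨j, hj⟩ := exists_pow_lt_of_lt_one (div_pos hδ hε) (by norm_num : (1/2:ℝ) < 1)
      refine ⟨j, (hrle j).trans_lt ?_⟩
      rw [lt_div_iff₀ hε] at hj
      linarith
    let A : ℕ → Set X := fun j => {z | r (j+1) < dist z x} ∩ {z | dist z x < r j}
    have hAo : ∀ j, IsOpen (A j) := fun j =>
      (isOpen_lt continuous_const (by fun_prop)).inter (isOpen_lt (by fun_prop) continuous_const)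
    have hyA : ∀ j, y (r j) ∈ A j := fun j => ⟨(hs _ (hrpos j)).2.2.1, (hs _ (hrpos j)).2.2.2⟩
    have hAinj : ∀ i j z, z ∈ A i → z ∈ A j → i = j := by
      intro i j z hi hj
      rcases lt_trichotomy i j with h | h | h
      · have := hranti (Nat.succ_le_of_lt h)
        exact absurd (hj.2.trans_le this) (not_lt.2 hi.1.le)
      · exact h
      · have := hranti (Nat.succ_le_of_lt h)
        exact absurd (hi.2.trans_le this) (not_lt.2 hj.1.le)
    choose R S hRc hRA hyR hSR hSc hSf hSt using fun j => ih (y (r j)) (A j) (hAo j) (hyA j)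
    refine ⟨insert x (⋃ j, R j), fun i => R i ∪ ⋃ j ∈ Finset.range i, S j i, ?_, ?_,
      mem_insert _ _, ?_, ?_, ?_, ?_⟩
    · rw [isCompact_iff_ultrafilter_le_nhds]
      intro f hf
      by_cases hN : ∃ N, (⋃ j ∈ Finset.range N, R j) ∈ f
      · obtain ⟨N, hN⟩ := hN
        have hc : IsCompact (⋃ j ∈ Finset.range N, R j) :=
          (Finset.range N).isCompact_biUnion fun j _ => hRc j
        obtain ⟨a, ha, hfa⟩ := isCompact_iff_ultrafilter_le_nhds.1 hc f
          (Filter.le_principal_iff.2 hN)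
        refine ⟨a, mem_insert_of_mem _ ?_, hfa⟩
        obtain ⟨j, -, hj⟩ := mem_iUnion₂.1 ha
        exact mem_iUnion.2 ⟨j, hj⟩
      · push Not at hN
        refine ⟨x, mem_insert _ _, ?_⟩
        intro V hV
        obtain ⟨δ, hδ, hδV⟩ := Metric.mem_nhds_iff.1 hV
        obtain ⟨N, hNδ⟩ := hrlim δ hδ
        have h1 := Ultrafilter.compl_mem_iff_notMem.2 (hN N)
        have h2 := Filter.le_principal_iff.1 hf
        refine Filter.mem_of_superset (Filter.inter_mem h1 h2) ?_
        rintro z ⟨hz1, hz2⟩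
        apply hδV
        rcases hz2 with rfl | hz2
        · exact Metric.mem_ball_self hδ
        · obtain ⟨j, hj⟩ := mem_iUnion.1 hz2
          have hjN : N ≤ j := by
            by_contra hlt
            exact hz1 (mem_iUnion₂.2 ⟨j, Finset.mem_range.2 (not_le.1 hlt), hj⟩)
          exact ((hRA j hj).2.trans_le (hranti hjN)).trans hNδ
    · refine insert_subset hx (iUnion_subset fun j z hz => hεO ?_)
      exact (hRA j hz).2.trans_le (hranti (Nat.zero_le j))
    · intro i
      refine union_subset ?_ ?_
      · exact (subset_iUnion R i).trans (subset_insert _ _)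
      · exact iUnion₂_subset fun j _ => (hSR j i).trans ((subset_iUnion R j).trans (subset_insert _ _))
    · intro i
      exact (hRc i).union ((Finset.range i).isCompact_biUnion fun j _ => hSc j i)
    · intro p
      by_cases hp : ∃ j, p ∈ R j
      · obtain ⟨j, hj⟩ := hp
        refine ((hSf j p).insert j).subset ?_
        rintro i (hi | hi)
        · exact Or.inl (hAinj i j p (hRA i hi) (hRA j hj))
        · obtain ⟨k, -, hk⟩ := mem_iUnion₂.1 hi
          have : k = j := hAinj k j p (hRA k (hSR k i hk)) (hRA j hj)
          subst this
          exact Or.inr hk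
      · convert Set.finite_empty (α := ℕ)
        rw [Set.eq_empty_iff_forall_notMem]
        rintro i (hi | hi)
        · exact hp ⟨i, hi⟩
        · obtain ⟨k, -, hk⟩ := mem_iUnion₂.1 hi
          exact hp ⟨k, hSR k i hk⟩
    · intro t ht
      rcases t.eq_empty_or_nonempty with rfl | hne
      · exact ⟨x, mem_insert _ _, by simp⟩
      · let j := t.min' hne
        have hj : j ∈ t := t.min'_mem hne
        obtain ⟨p, hpR, hp⟩ := hSt j (t.erase j) (by
          rw [Finset.card_erase_of_mem hj]; omega)
        refine ⟨p, mem_insert_of_mem _ (mem_iUnion.2 ⟨j, hpR⟩), ?_⟩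
        intro i hi
        by_cases hij : i = j
        · subst hij; exact Or.inl hpR
        · have hlt : j < i := lt_of_le_of_ne (t.min'_le i hi) (Ne.symm hij)
          exact Or.inr (mem_iUnion₂.2 ⟨j, Finset.mem_range.2 hlt,
            hp i (Finset.mem_erase.2 ⟨hij, hi⟩)⟩)

theorem exists_seq {X : Type} [MetricSpace X] [NoncompactSpace X] :
    ∃ x : ℕ → X, ∀ a, ∃ ε > 0, ∃ N, ∀ n ≥ N, ε ≤ dist (x n) a := by
  have h : ¬ IsSeqCompact (univ : Set X) := by
    rw [← isCompact_iff_isSeqCompact]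
    exact noncompact_univ X
  unfold IsSeqCompact at h
  push Not at h
  obtain ⟨x, -, hx⟩ := h
  refine ⟨x, fun a => ?_⟩
  by_contra hcon
  push Not at hcon
  have : MapClusterPt a Filter.atTop x := by
    rw [mapClusterPt_iff_frequently]
    intro s hs
    obtain ⟨ε, hε, hs⟩ := Metric.mem_nhds_iff.1 hs
    rw [Filter.frequently_atTop]
    intro N
    obtain ⟨n, hn, hd⟩ := hcon ε hε N
    exact ⟨n, hn, hs hd⟩
  obtain ⟨φ, hφ, hlim⟩ := this.tendsto_subseq
  exact hx a (mem_univ _) φ hφ hlim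

theorem far_exists {X : Type} [MetricSpace X] [NoncompactSpace X]
    (hcrowd : ∀ x : X, ¬ IsOpen ({x} : Set X)) :
    ∃ F : Set (StoneCech X), IsClosed F ∧ F.Nonempty ∧ IsFarSet F ∧
        setChar F ≤ dominatingNumber := by
  obtain ⟨x, hx⟩ := exists_seq (X := X)
  obtain ⟨ι, φ, hinf, hcard, hdom⟩ := dom_family
  have hε : ∀ n : ℕ, (0:ℝ) < 1 / ((n:ℝ) + 1) := fun n => by positivity
  choose R S hRc hRO hxR hSR hSc hSf hSt using fun n : ℕ =>
    tower hcrowd n (x n) (Metric.ball (x n) (1 / ((n:ℝ) + 1))) Metric.isOpen_ball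
      (Metric.mem_ball_self (hε n))
  let δ : ℕ → ℕ → ℝ := fun n k => 1 / ((n:ℝ) + k + 1)
  have hδ : ∀ n k, 0 < δ n k := fun n k => by positivity
  let u : (ℕ → ℕ) → (ℕ → ℕ) → ℕ → Set X := fun g h n => Metric.thickening (δ n (h n)) (S n (g n))
  have hlf : ∀ g h, LocallyFinite (u g h) := by
    intro g h a
    obtain ⟨ε, hε0, N, hN⟩ := hx a
    refine ⟨Metric.ball a (ε / 2), Metric.ball_mem_nhds _ (by linarith), ?_⟩
    obtain ⟨M, hM⟩ := exists_nat_one_div_lt (show 0 < ε / 4 by linarith)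
    refine (Set.finite_Iio (max N M)).subset ?_
    rintro n ⟨z, hz, hza⟩
    simp only [mem_Iio]
    by_contra hn
    push Not at hn
    obtain ⟨w, hw, hzw⟩ := Metric.mem_thickening_iff.1 hz
    have h1 := hN n ((le_max_left _ _).trans hn)
    have h2 : 1 / ((n:ℝ) + 1) ≤ 1 / ((M:ℝ) + 1) := by
      have := (le_max_right N M).trans hn
      gcongr
    have h3 : δ n (h n) ≤ 1 / ((n:ℝ) + 1) := by
      apply one_div_le_one_div_of_le (by positivity)
      have : (0:ℝ) ≤ h n := by positivity
      linarith
    have h4 : dist w (x n) < 1 / ((n:ℝ) + 1) := hRO n (hSR n _ hw)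
    have h5 : dist z a < ε / 2 := hza
    have h6 := dist_triangle4 (x n) w z a
    rw [dist_comm (x n) w, dist_comm w z] at h6
    linarith
  let U : ι × ι → Set X := fun p => ⋃ n, u (φ p.1) (φ p.2) n
  have hUo : ∀ p, IsOpen (U p) := fun p => isOpen_iUnion fun n => Metric.isOpen_thickening
  have hUcl : ∀ p, closure (U p) ⊆ ⋃ n, Metric.cthickening (δ n (φ p.2 n)) (S n (φ p.1 n)) := by
    intro p
    rw [(hlf _ _).closure_iUnion]
    exact iUnion_mono fun n => Metric.closure_thickening_subset_cthickening _ _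
  have hclcl : ∀ A : Set X, closure (stoneCechUnit '' A) = closure (stoneCechUnit '' closure A) := by
    intro A
    refine (closure_mono (image_mono subset_closure)).antisymm ?_
    exact closure_minimal (image_closure_subset_closure_image continuous_stoneCechUnit)
      isClosed_closure
  let c : ι × ι → Set (StoneCech X) := fun p => closure (stoneCechUnit '' U p)
  let W : ι × ι → Set (StoneCech X) := fun p => (closure (stoneCechUnit '' (U p)ᶜ))ᶜ
  have hsep : ∀ (p : ι × ι) (D : Set X), IsClosed D → Disjoint (closure (U p)) D →
      Disjoint (c p) (closure (stoneCechUnit '' D)) := by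
    intro p D hD hd
    simp only [c]
    rw [hclcl]
    exact sc_disjoint isClosed_closure hD hd
  refine ⟨⋂ p, c p, isClosed_iInter fun p => isClosed_closure, ?_, ?_, ?_⟩
  · have := isCompact_univ.inter_iInter_nonempty c (fun p => isClosed_closure) (by
      intro t
      let n := t.card
      obtain ⟨p, -, hp⟩ := hSt n (t.image fun p => φ p.1 n) Finset.card_image_le
      refine ⟨stoneCechUnit p, mem_univ _, mem_iInter₂.2 fun i hi => subset_closure ⟨p, ?_, rfl⟩⟩
      refine mem_iUnion.2 ⟨n, Metric.self_subset_thickening (hδ _ _) _ ?_⟩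
      exact hp _ (Finset.mem_image_of_mem _ hi))
    simpa using this
  · intro D hD hdisc
    -- D meets each compact set in a finite set
    have hfin : ∀ n, (D ∩ R n).Finite := by
      intro n
      have hc : IsCompact (D ∩ R n) := (hRc n).inter_left hD
      choose! V hVo hxV hV using hdisc
      obtain ⟨t, hcov⟩ := hc.elim_nhds_subcover' (fun z _ => V z)
        (fun z hz => (hVo z hz.1).mem_nhds (hxV z hz.1))
      refine (t.finite_toSet.image Subtype.val).subset ?_
      intro z hz
      obtain ⟨w, hw, hzw⟩ := mem_iUnion₂.1 (hcov hz)
      have : z ∈ V w ∩ D := ⟨hzw, hz.1⟩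
      rw [hV w w.2.1] at this
      exact ⟨w, hw, this.symm⟩
    have hf : ∀ n, ∃ k, ∀ i ≥ k, Disjoint (S n i) D := by
      intro n
      have h1 : (⋃ d ∈ D ∩ R n, {i | d ∈ S n i}).Finite := (hfin n).biUnion fun d _ => hSf n d
      obtain ⟨k, hk⟩ := h1.bddAbove
      refine ⟨k + 1, fun i hi => Set.disjoint_left.2 fun d hd hdD => ?_⟩
      have := hk (mem_biUnion (show d ∈ D ∩ R n from ⟨hdD, hSR n i hd⟩) hd)
      omega
    choose f hf using hf
    obtain ⟨g, hg⟩ := hdom f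
    have hh : ∀ n, ∃ k : ℕ, ∀ j ≥ k, Disjoint (Metric.cthickening (δ n j) (S n (φ g n))) D := by
      intro n
      obtain ⟨η, hη, hd⟩ := (hf n _ (hg n)).exists_cthickenings (hSc n _) hD
      obtain ⟨k, hk⟩ := exists_nat_one_div_lt hη
      refine ⟨k, fun j hj => hd.mono (Metric.cthickening_mono ?_ _)
        (Metric.self_subset_cthickening _)⟩
      refine le_trans ?_ hk.le
      apply one_div_le_one_div_of_le (by positivity)
      have : (k:ℝ) ≤ j := by exact_mod_cast hj
      have : (0:ℝ) ≤ n := by positivity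
      linarith
    choose h hh using hh
    obtain ⟨g', hg'⟩ := hdom h
    have hdj : Disjoint (closure (U (g, g'))) D := by
      refine Disjoint.mono_left (hUcl _) ?_
      rw [Set.disjoint_iUnion_left]
      exact fun n => hh n _ (hg' n)
    have := hsep (g, g') D hD hdj
    exact disjoint_iff_inter_eq_empty.1 (this.mono_left (iInter_subset _ _))
  · refine (setChar_le (ι := ι × ι) _ c W (fun p => isClosed_closure)
      (fun p => isClosed_closure.isOpen_compl) ?_ rfl ?_).trans ?_
    · intro p z hz
      have : z ∈ closure (range (stoneCechUnit : X → StoneCech X)) := denseRange_stoneCechUnit z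
      rw [← image_univ, ← union_compl_self (U p), image_union, closure_union] at this
      exact this.resolve_right hz
    · rintro ⟨g, h⟩
      obtain ⟨h', hh'⟩ := hdom (fun n => φ h n + 1)
      refine (iInter_subset c (g, h')).trans ?_
      refine Set.subset_compl_iff_disjoint_right.2 (hsep _ _ (hUo _).isClosed_compl ?_)
      rw [Set.disjoint_compl_right_iff_subset]
      refine (hUcl _).trans (iUnion_mono fun n => ?_)
      refine Metric.cthickening_subset_thickening' (hδ _ _) ?_ _
      apply one_div_lt_one_div_of_lt (by positivity)
      have : ((φ h n : ℕ) : ℝ) + 1 ≤ φ h' n := by exact_mod_cast hh' n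
      simp only
      linarith
    · rw [Cardinal.mk_prod]
      simp only [Cardinal.lift_id]
      rw [Cardinal.mul_eq_self (Cardinal.aleph0_le_mk ι), hcard]

theorem far_lower' {X : Type} [MetricSpace X] [TopologicalSpace.SeparableSpace X]
    (F : Set (StoneCech X)) (hne : F.Nonempty) (hfar : IsFarSet F) :
    dominatingNumber ≤ setChar F := by
  obtain ⟨e, he⟩ := Metric.PiNatEmbed.exists_embedding_to_hilbert_cube (X := X)
  letI := TopologicalSpace.metrizableSpaceMetric (ℕ → unitInterval)
  exact far_lower e he F hne hfar

/-- For every non-compact, crowded, separable metrizable space `X`, the minimal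
character of a far closed set equals 𝔡: there is a nonempty far closed set of
character 𝔡, and every nonempty far closed set has character at least 𝔡. -/
theorem statement12 {X : Type} [TopologicalSpace X] [TopologicalSpace.MetrizableSpace X]
    [TopologicalSpace.SeparableSpace X] [NoncompactSpace X]
    (hcrowd : ∀ x : X, ¬ IsOpen ({x} : Set X)) :
    (∃ F : Set (StoneCech X), IsClosed F ∧ F.Nonempty ∧ IsFarSet F ∧
        setChar F = dominatingNumber) ∧
    ∀ F : Set (StoneCech X), IsClosed F → F.Nonempty → IsFarSet F →
      dominatingNumber ≤ setChar F := by
  letI := TopologicalSpace.metrizableSpaceMetric X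
  refine ⟨?_, fun F _ hne hfar => far_lower' F hne hfar⟩
  obtain ⟨F, h1, h2, h3, h4⟩ := far_exists hcrowd
  exact ⟨F, h1, h2, h3, h4.antisymm (far_lower' F h2 h3)⟩
end

section
/- If X is a countable regular crowded space whose π-weight is a cardinal of uncountable cofinality, then X has a far point. -/
open Set Topology

/-- The π-weight of a space: the least cardinality of a π-base, i.e. a family of
nonempty open sets such that every nonempty open set contains a member. -/
noncomputable def piWeight (X : Type*) [TopologicalSpace X] : Cardinal :=
  sInf { c | ∃ B : Set (Set X), Cardinal.mk B = c ∧ (∀ U ∈ B, IsOpen U ∧ U.Nonempty) ∧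
    ∀ V : Set X, IsOpen V → V.Nonempty → ∃ U ∈ B, U ⊆ V }

open Cardinal

namespace FarPt

lemma sep {X : Type} [TopologicalSpace X] [T3Space X] [Countable X] {S T : Set X}
    (hS : IsClosed S) (hT : IsOpen T) (h : S ⊆ T) : ∃ C : Set X, IsClopen C ∧ S ⊆ C ∧ C ⊆ T := by
  obtain ⟨f, hf0, hf1, -⟩ := exists_continuous_zero_one_of_isClosed hS hT.isClosed_compl
    (disjoint_compl_right_iff_subset.2 h)
  have hc : (range f).Countable := countable_range f
  have : ∃ r ∈ Ioo (0:ℝ) 1, r ∉ range f := by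
    by_contra! hcon
    have h1 : (Ioo (0:ℝ) 1).Countable := hc.mono hcon
    exact absurd h1 (by
      intro h2
      have := (Cardinal.le_aleph0_iff_set_countable).2 h2
      rw [Cardinal.mk_Ioo_real one_pos] at this
      exact absurd this (not_le.2 Cardinal.aleph0_lt_continuum))
  obtain ⟨r, hr, hrf⟩ := this
  refine ⟨f ⁻¹' Iio r, ⟨?_, isOpen_Iio.preimage f.continuous⟩, ?_, ?_⟩
  · have : f ⁻¹' Iio r = f ⁻¹' Iic r := by
      ext x
      simp only [mem_preimage, mem_Iio, mem_Iic]
      exact ⟨le_of_lt, fun h => lt_of_le_of_ne h fun e => hrf ⟨x, e⟩⟩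
    rw [this]
    exact isClosed_Iic.preimage f.continuous
  · intro x hx
    have := hf0 hx
    simp only [mem_preimage, mem_Iio, this]
    exact hr.1
  · intro x hx
    by_contra hxT
    have := hf1 hxT
    simp only [mem_preimage, mem_Iio, this] at hx
    exact absurd hx (not_lt.2 hr.2.le)

/-- every family of fewer than `κ` nonempty open sets is avoided by a neighborhood of `x` -/
def Good {X : Type} [TopologicalSpace X] (κ : Cardinal.{0}) (x : X) : Prop :=
  ∀ A : Set (Set X), #A < κ → (∀ a ∈ A, IsOpen a ∧ a.Nonempty) →
    ∃ U : Set X, IsOpen U ∧ x ∈ U ∧ ∀ a ∈ A, ¬ a ⊆ U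

lemma shrink {X : Type} [TopologicalSpace X] [T3Space X] [Countable X] {κ : Cardinal.{0}}
    {D : Set X} (hD : IsClosed D) (hdisc : IsDiscreteSubset D) (hg : ∀ x ∈ D, Good κ x)
    {A : Set (Set X)} (hA : #A < κ) (hA' : ∀ a ∈ A, IsOpen a ∧ a.Nonempty)
    {U : Set X} (hU : IsOpen U) (hDU : D ⊆ U) :
    ∃ C : Set X, IsClopen C ∧ D ⊆ C ∧ C ⊆ U ∧ ∀ a ∈ A, ¬ a ⊆ C := by
  classical
  obtain ⟨e, he⟩ := exists_injective_nat X
  have h1 : ∀ x : X, ∃ O : Set X, IsClopen O ∧ (x ∈ D → x ∈ O ∧ O ∩ D = {x}) := by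
    intro x
    by_cases hx : x ∈ D
    · obtain ⟨O, hO, hxO, hOD⟩ := hdisc x hx
      obtain ⟨C, hC, h1, h2⟩ := sep (isClosed_singleton (x := x)) hO (by simpa using hxO)
      refine ⟨C, hC, fun _ => ⟨by simpa using h1, ?_⟩⟩
      apply Subset.antisymm
      · rw [← hOD]; exact inter_subset_inter_left _ h2
      · intro y hy
        rw [mem_singleton_iff.1 hy]
        exact ⟨by simpa using h1, hx⟩
    · exact ⟨∅, isClopen_empty, fun h => absurd h hx⟩
  choose O hO hO' using h1
  let V : X → Set X := fun x => O x \ ⋃ y ∈ {y : X | y ∈ D ∧ e y < e x}, O y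
  have hfin : ∀ x, {y : X | y ∈ D ∧ e y < e x}.Finite := fun x =>
    ((finite_Iio (e x)).preimage he.injOn).subset fun y hy => hy.2
  have hV : ∀ x, IsClopen (V x) := fun x =>
    (hO x).diff ((hfin x).isClopen_biUnion fun y _ => hO y)
  have hxV : ∀ x ∈ D, x ∈ V x := by
    intro x hx
    refine ⟨(hO' x hx).1, ?_⟩
    simp only [mem_iUnion, not_exists]
    rintro y ⟨hy, hlt⟩ hxy
    have : x ∈ O y ∩ D := ⟨hxy, hx⟩
    rw [(hO' y hy).2] at this
    rw [mem_singleton_iff.1 this] at hlt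
    exact lt_irrefl _ hlt
  have hdj : ∀ x ∈ D, ∀ y ∈ D, ∀ z, z ∈ V x → z ∈ V y → x = y := by
    intro x hx y hy z hzx hzy
    rcases lt_trichotomy (e x) (e y) with h | h | h
    · exact absurd (mem_biUnion (show x ∈ {w : X | w ∈ D ∧ e w < e y} from ⟨hx, h⟩) hzx.1) hzy.2
    · exact he h
    · exact absurd (mem_biUnion (show y ∈ {w : X | w ∈ D ∧ e w < e x} from ⟨hy, h⟩) hzy.1) hzx.2
  have h2 : ∀ x : X, ∃ W : Set X, IsOpen W ∧ (x ∈ D → x ∈ W ∧ ∀ a ∈ A, (a ∩ V x).Nonempty →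
      ¬ a ∩ V x ⊆ W) := by
    intro x
    by_cases hx : x ∈ D
    · obtain ⟨W, hW, hxW, hWA⟩ := hg x hx {b | b ∈ (fun a => a ∩ V x) '' A ∧ b.Nonempty}
        (lt_of_le_of_lt ((Cardinal.mk_le_mk_of_subset (fun b hb => hb.1)).trans
          Cardinal.mk_image_le) hA) (by
        rintro b ⟨⟨a, ha, rfl⟩, hb⟩
        exact ⟨(hA' a ha).1.inter (hV x).isOpen, hb⟩)
      exact ⟨W, hW, fun _ => ⟨hxW, fun a ha hne => hWA _ ⟨⟨a, ha, rfl⟩, hne⟩⟩⟩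
    · exact ⟨∅, isOpen_empty, fun h => absurd h hx⟩
  choose W hW hW' using h2
  obtain ⟨C, hC, hDC, hCU⟩ := sep hD (T := U ∩ ⋃ x ∈ D, (W x ∩ V x))
    (hU.inter (isOpen_biUnion fun x _ => (hW x).inter (hV x).isOpen))
    (fun x hx => ⟨hDU hx, mem_biUnion hx ⟨(hW' x hx).1, hxV x hx⟩⟩)
  refine ⟨C, hC, hDC, fun x hx => (hCU hx).1, ?_⟩
  intro a ha haC
  obtain ⟨z, hz⟩ := (hA' a ha).2
  obtain ⟨x, hx, hzx⟩ := mem_iUnion₂.1 (hCU (haC hz)).2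
  refine (hW' x hx).2 a ha ⟨z, hz, hzx.2⟩ ?_
  rintro w ⟨hwa, hwV⟩
  obtain ⟨y, hy, hwy⟩ := mem_iUnion₂.1 (hCU (haC hwa)).2
  rw [hdj x hx y hy w hwV hwy.2]
  exact hwy.1

lemma exists_good {X : Type} [TopologicalSpace X] [Countable X]
    (hcof : Cardinal.aleph0 < (piWeight X).ord.cof) :
    ∃ V : Set X, IsOpen V ∧ V.Nonempty ∧ ∀ x ∈ V, Good (piWeight X) x := by
  classical
  set κ := piWeight X with hκ
  have hκ0 : ℵ₀ < κ := hcof.trans_le (by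
    simpa using Ordinal.cof_le_card κ.ord)
  have h1 : ∀ x : X, ∃ A : Set (Set X), #A < κ ∧ (∀ a ∈ A, IsOpen a ∧ a.Nonempty) ∧
      (¬ Good κ x → ∀ U : Set X, IsOpen U → x ∈ U → ∃ a ∈ A, a ⊆ U) := by
    intro x
    by_cases h : Good κ x
    · exact ⟨∅, by simpa using (Cardinal.aleph0_pos.trans hκ0), by simp, fun h' => absurd h h'⟩
    · have h' := h
      unfold Good at h'
      push Not at h'
      obtain ⟨A, hA, hA1, hA2⟩ := h'
      exact ⟨A, hA, hA1, fun _ => hA2⟩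
  choose A hA hA1 hA2 using h1
  have hlt : #(⋃ x, A x : Set (Set X)) < κ := by
    refine (Cardinal.mk_iUnion_le A).trans_lt ?_
    refine Cardinal.mul_lt_of_lt hκ0.le ?_ ?_
    · exact (Cardinal.mk_le_aleph0).trans_lt hκ0
    · exact Cardinal.iSup_lt_of_lt_cof_ord (Cardinal.mk_le_aleph0.trans_lt hcof) hA
  by_contra! hcon
  refine absurd hlt (not_lt.2 ?_)
  rw [hκ]
  refine csInf_le' ⟨_, rfl, ?_, ?_⟩
  · intro U hU
    obtain ⟨x, hx⟩ := mem_iUnion.1 hU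
    exact hA1 x U hx
  · intro V hV hne
    obtain ⟨x, hx, hb⟩ := hcon V hV hne
    obtain ⟨a, ha, haV⟩ := hA2 x hb V hV hx
    exact ⟨a, mem_iUnion.2 ⟨x, ha⟩, haV⟩

lemma partition {X : Type} [TopologicalSpace X] [T3Space X] [Countable X]
    (hcrowd : ∀ x : X, ¬ IsOpen ({x} : Set X)) {V : Set X} (hV : IsOpen V) (hne : V.Nonempty) :
    ∃ C : ℕ → Set X, (∀ n, IsClopen (C n)) ∧ (∀ n, (C n).Nonempty) ∧ (∀ n, C n ⊆ V) ∧
      (∀ m n x, x ∈ C m → x ∈ C n → m = n) ∧ IsClopen (⋃ n, C n) := by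
  classical
  obtain ⟨y, hy⟩ := hne
  obtain ⟨Y, hY, hyY, hYV⟩ := sep (isClosed_singleton (x := y)) hV (by simpa using hy)
  have hYne : Y.Nonempty := ⟨y, by simpa using hyY⟩
  have : Nonempty X := ⟨y⟩
  obtain ⟨f, hf⟩ := exists_surjective_nat X
  have step : ∀ (x : X) (W : {W : Set X // IsClopen W ∧ W.Nonempty}),
      ∃ W' : {W : Set X // IsClopen W ∧ W.Nonempty},
        W'.1 ⊆ W.1 ∧ x ∉ W'.1 ∧ (W.1 \ W'.1).Nonempty := by
    rintro x ⟨W, hW, a, ha⟩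
    have h1 : ∃ b ∈ W, b ≠ a := by
      by_contra! h
      apply hcrowd a
      have : W = {a} := Subset.antisymm (fun b hb => h b hb) (by simpa using ha)
      rw [← this]; exact hW.isOpen
    obtain ⟨b, hb, hba⟩ := h1
    have h2 : ∃ p ∈ W, ∃ q ∈ W, p ≠ x ∧ p ≠ q := by
      by_cases hax : a = x
      · exact ⟨b, hb, a, ha, by rwa [← hax], hba⟩
      · exact ⟨a, ha, b, hb, hax, hba.symm⟩
    obtain ⟨p, hp, q, hq, hpx, hpq⟩ := h2
    obtain ⟨C, hC, hpC, hCT⟩ := sep (isClosed_singleton (x := p)) (T := W ∩ ({x}ᶜ ∩ {q}ᶜ))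
      (hW.isOpen.inter (isOpen_compl_singleton.inter isOpen_compl_singleton))
      (by simpa using ⟨hp, hpx.symm, hpq.symm⟩)
    exact ⟨⟨C, hC, p, by simpa using hpC⟩, fun z hz => (hCT hz).1, fun h => (hCT h).2.1 rfl,
      q, hq, fun h => (hCT h).2.2 rfl⟩
  choose g hg1 hg2 hg3 using step
  let W : ℕ → {W : Set X // IsClopen W ∧ W.Nonempty} :=
    fun n => Nat.rec ⟨Y, hY, hYne⟩ (fun k w => g (f k) w) n
  have hW0 : (W 0).1 = Y := rfl
  have hWs : ∀ n, W (n+1) = g (f n) (W n) := fun n => rfl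
  have hanti : Antitone fun n => (W n).1 := antitone_nat_of_succ_le fun n => by
    rw [hWs]; exact hg1 _ _
  have hU : (⋃ n, (W n).1 \ (W (n+1)).1) = Y := by
    apply Subset.antisymm
    · exact iUnion_subset fun n => sdiff_subset.trans (hanti (Nat.zero_le n))
    · intro x hx
      obtain ⟨k, rfl⟩ := hf x
      have hk : ∃ n, f k ∉ (W n).1 := ⟨k+1, by rw [hWs]; exact hg2 _ _⟩
      have h0 : Nat.find hk ≠ 0 := by
        intro h
        have := Nat.find_spec hk
        rw [h] at this
        exact this hx
      obtain ⟨m, hm⟩ := Nat.exists_eq_succ_of_ne_zero h0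
      refine mem_iUnion.2 ⟨m, ?_, ?_⟩
      · have := Nat.find_min hk (m := m) (by omega)
        simpa using this
      · have := Nat.find_spec hk
        rw [hm] at this
        exact this
  refine ⟨fun n => (W n).1 \ (W (n+1)).1, fun n => (W n).2.1.diff (W (n+1)).2.1, ?_, ?_, ?_, ?_⟩
  · intro n; exact hg3 _ _
  · intro n
    exact (sdiff_subset.trans (hanti (Nat.zero_le n))).trans hYV
  · intro m n x hm hn
    rcases lt_trichotomy m n with h | h | h
    · exact absurd (hanti (Nat.succ_le_of_lt h) hn.1) hm.2
    · exact h
    · exact absurd (hanti (Nat.succ_le_of_lt h) hm.1) hn.2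
  · rw [hU]; exact hY

/-- filtration of a pi-base -/
lemma filtration {X : Type} [TopologicalSpace X] [Countable X]
    (hcof : Cardinal.aleph0 < (piWeight X).ord.cof)
    (C : ℕ → Set X) (hC : ∀ n, IsClopen (C n)) (hCne : ∀ n, (C n).Nonempty) :
    ∃ (ι : Type) (_ : LinearOrder ι) (_ : Nonempty ι) (A : ι → Set (Set X)),
      (∀ i, #(A i) < piWeight X) ∧ (∀ i, ∀ a ∈ A i, IsOpen a ∧ a.Nonempty) ∧
      Monotone A ∧ (∀ i n, C n ∈ A i) ∧
      (∀ i, ∀ a ∈ A i, ∀ b ∈ A i, (a ∩ b).Nonempty → a ∩ b ∈ A i) ∧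
      (∀ (G : Set X) (i₀ : ι), IsClopen G → ∃ i ≥ i₀, ∀ O : Set X, IsOpen O → (O ∩ G).Nonempty →
        ∃ a ∈ A i, a ⊆ G ∧ (a ∩ O).Nonempty) := by
  classical
  have hmem : piWeight X ∈ { c | ∃ B : Set (Set X), Cardinal.mk B = c ∧
      (∀ U ∈ B, IsOpen U ∧ U.Nonempty) ∧
      ∀ V : Set X, IsOpen V → V.Nonempty → ∃ U ∈ B, U ⊆ V } :=
    csInf_mem ⟨_, {U | IsOpen U ∧ U.Nonempty}, rfl, fun U h => h, fun V h1 h2 =>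
      ⟨V, ⟨h1, h2⟩, Subset.rfl⟩⟩
  set κ := piWeight X with hκ
  have hκ0 : ℵ₀ < κ := hcof.trans_le (by
    simpa using Ordinal.cof_le_card κ.ord)
  obtain ⟨B, hBκ, hB1, hB2⟩ := hmem
  let ι := κ.ord.ToType
  have hι : #ι = κ := by simp [ι]
  have hne : Nonempty ι := by
    rw [← Cardinal.mk_ne_zero_iff, hι]
    exact (Cardinal.aleph0_pos.trans hκ0).ne'
  obtain ⟨φ⟩ : Nonempty (ι ≃ B) := Cardinal.eq.1 (hι.trans hBκ.symm)
  have hbdd : ∀ f : X → ι, ∃ i, ∀ x, f x < i := by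
    intro f
    have h : ¬ IsCofinal (range f) := by
      intro h
      have h1 := Order.cof_le h
      rw [Ordinal.cof_toType] at h1
      exact absurd (h1.trans (Cardinal.mk_range_le.trans Cardinal.mk_le_aleph0)) (not_le.2 hcof)
    unfold IsCofinal at h
    push Not at h
    obtain ⟨i, hi⟩ := h
    exact ⟨i, fun x => hi _ ⟨x, rfl⟩⟩
  let gen : ℕ ⊕ ι → Set X := Sum.elim C (fun j => (φ j).1)
  have hgen : ∀ s, IsOpen (gen s) := by
    rintro (n | j)
    · exact (hC n).isOpen
    · exact (hB1 _ (φ j).2).1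
  let A : ι → Set (Set X) := fun i => {a | a.Nonempty ∧ ∃ s : Finset (ℕ ⊕ ι),
    (∀ j, Sum.inr j ∈ s → j < i) ∧ a = ⋂ t ∈ s, gen t}
  refine ⟨ι, inferInstance, hne, A, ?_, ?_, ?_, ?_, ?_, ?_⟩
  · intro i
    let F : Finset (ℕ ⊕ Iio i) → Set X := fun s => ⋂ t ∈ s, gen (Sum.map id Subtype.val t)
    have hsub : A i ⊆ range F := by
      rintro a ⟨-, s, hs, rfl⟩
      refine ⟨s.preimage (Sum.map id Subtype.val)
        (Function.Injective.sumMap Function.injective_id Subtype.val_injective).injOn, ?_⟩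
      ext x
      simp only [F, mem_iInter, Finset.mem_preimage]
      constructor
      · rintro h (n | j) hj
        · exact h (Sum.inl n) hj
        · exact h (Sum.inr ⟨j, hs j hj⟩) hj
      · intro h t ht
        exact h _ ht
    refine ((Cardinal.mk_le_mk_of_subset hsub).trans Cardinal.mk_range_le).trans_lt ?_
    rw [Cardinal.mk_finset_of_infinite, Cardinal.mk_sum]
    simp only [Cardinal.lift_id]
    exact Cardinal.add_lt_of_lt hκ0.le (by simpa using hκ0) (Cardinal.mk_Iio_toType_ord_lt i)
  · rintro i a ⟨hne, s, -, rfl⟩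
    exact ⟨isOpen_biInter_finset fun t _ => hgen t, hne⟩
  · rintro i j hij a ⟨hne, s, hs, rfl⟩
    exact ⟨hne, s, fun k hk => (hs k hk).trans_le hij, rfl⟩
  · intro i n
    exact ⟨hCne n, {Sum.inl n}, by simp, by simp [gen]⟩
  · rintro i _ ⟨-, s, hs, rfl⟩ _ ⟨-, t, ht, rfl⟩ hne
    refine ⟨hne, s ∪ t, ?_, ?_⟩
    · intro j hj
      rcases Finset.mem_union.1 hj with h | h
      · exact hs j h
      · exact ht j h
    · ext x
      simp only [mem_inter_iff, mem_iInter, Finset.mem_union]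
      exact ⟨fun h t ht => ht.elim (h.1 t) (h.2 t), fun h =>
        ⟨fun t ht => h t (Or.inl ht), fun t ht => h t (Or.inr ht)⟩⟩
  · intro G i₀ hG
    have h1 : ∀ x : X, ∃ j : ι, (∃ j' : ι, x ∈ (φ j').1 ∧ (φ j').1 ⊆ G) →
        x ∈ (φ j).1 ∧ (φ j).1 ⊆ G := by
      intro x
      by_cases h : ∃ j' : ι, x ∈ (φ j').1 ∧ (φ j').1 ⊆ G
      · obtain ⟨j, hj⟩ := h
        exact ⟨j, fun _ => hj⟩
      · exact ⟨i₀, fun h' => absurd h' h⟩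
    choose f hf using h1
    obtain ⟨i, hi⟩ := hbdd f
    refine ⟨max i i₀, le_max_right _ _, ?_⟩
    intro O hO hOG
    obtain ⟨U, hU, hUV⟩ := hB2 _ (hO.inter hG.isOpen) hOG
    obtain ⟨x, hx⟩ := (hB1 U hU).2
    have hx' := hf x ⟨φ.symm ⟨U, hU⟩, by simpa using hx,
      by simpa using hUV.trans inter_subset_right⟩
    refine ⟨(φ (f x)).1, ⟨⟨x, hx'.1⟩, {Sum.inr (f x)}, ?_, by simp [gen]⟩, hx'.2, x, hx'.1,
      (hUV hx).1⟩
    intro j hj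
    simp only [Finset.mem_singleton, Sum.inr.injEq] at hj
    rw [hj]
    exact (hi x).trans_le (le_max_left _ _)

lemma linked {X ι T : Type} [LinearOrder ι] [DecidableEq T] (A : ι → Set (Set X))
    (hmono : Monotone A)
    (hint : ∀ i, ∀ a ∈ A i, ∀ b ∈ A i, (a ∩ b).Nonempty → a ∩ b ∈ A i)
    (F : ℕ → T → Set X) (α : ℕ → T → ι)
    (hF : ∀ D, Monotone fun n => F n D) (hα : ∀ n D, α n D ≤ α (n+1) D)
    (h : ∀ n D, ∀ a ∈ A (α n D), ∃ b ∈ A (α (n+1) D), b ⊆ F (n+1) D ∧ (b ∩ a).Nonempty) :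
    ∀ (m : ℕ) (s : Finset T), s.card = m → ∀ (j : ℕ) (a : Set X), a.Nonempty →
      (∀ D ∈ s, a ∈ A (α j D)) → ∃ x ∈ a, ∀ D ∈ s, x ∈ F (j + m) D := by
  intro m
  induction m with
  | zero =>
    intro s hs j a ha _
    obtain ⟨x, hx⟩ := ha
    rw [Finset.card_eq_zero] at hs
    subst hs
    exact ⟨x, hx, by simp⟩
  | succ m ih =>
    intro s hs j a ha has
    obtain ⟨D₀, hD₀, hmin⟩ := s.exists_min_image (α (j+1)) (Finset.card_pos.1 (by omega))
    obtain ⟨b, hb, hbF, hba⟩ := h j D₀ a (has D₀ hD₀)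
    obtain ⟨x, hx, hxs⟩ := ih (s.erase D₀) (by rw [Finset.card_erase_of_mem hD₀]; omega) (j+1)
      (b ∩ a) hba (by
        intro D hD
        have hDs := Finset.mem_of_mem_erase hD
        exact hint _ _ (hmono (hmin D hDs) hb) _ (hmono (hα j D) (has D hDs)) hba)
    refine ⟨x, hx.2, fun D hD => ?_⟩
    rw [show j + (m+1) = j + 1 + m by omega]
    by_cases hDD : D = D₀
    · subst hDD
      exact hF D (Nat.le_add_right (j+1) m) (hbF hx.1)
    · exact hxs D (Finset.mem_erase.2 ⟨hDD, hD⟩)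

end FarPt

/-- Every countable regular crowded space whose π-weight has uncountable cofinality
has a far point in its Čech–Stone remainder. -/
theorem statement17 {X : Type} [TopologicalSpace X] [T3Space X] [Countable X]
    (hcrowd : ∀ x : X, ¬ IsOpen ({x} : Set X))
    (hcof : Cardinal.aleph0 < (piWeight X).ord.cof) :
    ∃ p : StoneCech X,
      p ∉ Set.range (stoneCechUnit : X → StoneCech X) ∧
      ∀ D : Set X, IsClosed D → IsDiscreteSubset D →
        p ∉ closure (stoneCechUnit '' D) := by
  classical
  suffices hs : ∃ p : StoneCech X, ∀ D : Set X, IsClosed D → IsDiscreteSubset D →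
        p ∉ closure (stoneCechUnit '' D) by
    obtain ⟨p, hp⟩ := hs
    refine ⟨p, ?_, hp⟩
    rintro ⟨x, rfl⟩
    refine hp {x} isClosed_singleton ?_ (subset_closure ⟨x, rfl, rfl⟩)
    intro y hy
    rw [mem_singleton_iff.1 hy]
    exact ⟨univ, isOpen_univ, trivial, by simp⟩
  obtain ⟨V, hV, hVne, hgood⟩ := FarPt.exists_good hcof
  obtain ⟨C, hC, hCne, hCV, hCdj, hY⟩ := FarPt.partition hcrowd hV hVne
  obtain ⟨ι, _, hι, A, hAκ, hA, hmono, hCA, hint, hG⟩ := FarPt.filtration hcof C hC hCne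
  let T := {D : Set X // IsClosed D ∧ IsDiscreteSubset D}
  let Y : Set X := ⋃ n, C n
  -- a step: shrink the neighborhood and move up in the filtration
  have step : ∀ (D : T) (q : {U : Set X // IsClopen U ∧ D.1 ∩ Y ⊆ U} × ι),
      ∃ q' : {U : Set X // IsClopen U ∧ D.1 ∩ Y ⊆ U} × ι,
        q'.1.1 ⊆ q.1.1 ∧ q.2 ≤ q'.2 ∧
        ∀ a ∈ A q.2, ∃ b ∈ A q'.2, b ⊆ q'.1.1ᶜ ∧ (b ∩ a).Nonempty := by
    rintro ⟨D, hD, hdisc⟩ ⟨⟨U, hU, hDU⟩, i⟩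
    have hd : IsDiscreteSubset (D ∩ Y) := by
      rintro x ⟨hx, hxY⟩
      obtain ⟨O, hO, hxO, hOD⟩ := hdisc x hx
      refine ⟨O, hO, hxO, Subset.antisymm ?_ ?_⟩
      · rw [← hOD]; exact fun z hz => ⟨hz.1, hz.2.1⟩
      · intro z hz
        rw [mem_singleton_iff.1 hz]
        exact ⟨hxO, hx, hxY⟩
    obtain ⟨U', hU', hDU', hU'U, hU'A⟩ := FarPt.shrink (hD.inter hY.isClosed) hd
      (fun x hx => by
        obtain ⟨n, hn⟩ := mem_iUnion.1 hx.2
        exact hgood x (hCV n hn)) (hAκ i) (hA i) hU.isOpen hDU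
    obtain ⟨i', hi', hi⟩ := hG U'ᶜ i hU'.compl
    refine ⟨⟨⟨U', hU', hDU'⟩, i'⟩, hU'U, hi', ?_⟩
    intro a ha
    obtain ⟨z, hz, hzU⟩ := not_subset.1 (hU'A a ha)
    exact hi a (hA i a ha).1 ⟨z, hz, hzU⟩
  choose g hg1 hg2 hg3 using step
  let i₀ : ι := Classical.choice hι
  let Q : (D : T) → ℕ → {U : Set X // IsClopen U ∧ D.1 ∩ Y ⊆ U} × ι := fun D n =>
    Nat.rec ⟨⟨univ, isClopen_univ, subset_univ _⟩, i₀⟩ (fun _ q => g D q) n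
  have hQs : ∀ D n, Q D (n+1) = g D (Q D n) := fun D n => rfl
  have hlink := FarPt.linked A hmono hint
    (fun n (D : T) => (Q D n).1.1ᶜ) (fun n D => (Q D n).2)
    (fun D => monotone_nat_of_le_succ fun n => by
      rw [hQs]; exact compl_subset_compl.2 (hg1 _ _))
    (fun n D => by rw [hQs]; exact hg2 _ _)
    (fun n D => by rw [hQs]; exact hg3 _ _)
  let F : T → Set X := fun D => ⋃ n, C n \ (Q D n).1.1
  have hFD : ∀ D x, x ∈ F D → x ∉ D.1 := by
    intro D x hx hxD
    obtain ⟨n, hn, hn'⟩ := mem_iUnion.1 hx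
    exact hn' ((Q D n).1.2.2 ⟨hxD, mem_iUnion.2 ⟨n, hn⟩⟩)
  have hFopen : ∀ D, IsOpen (F D) := fun D =>
    isOpen_iUnion fun n => ((hC n).diff (Q D n).1.2.1).isOpen
  have hFclopen : ∀ D, IsClopen (F D) := by
    intro D
    refine ⟨?_, hFopen D⟩
    have : (F D)ᶜ = Yᶜ ∪ ⋃ n, C n ∩ (Q D n).1.1 := by
      ext x
      constructor
      · intro hx
        by_cases hxY : x ∈ Y
        · right
          obtain ⟨n, hn⟩ := mem_iUnion.1 hxY
          refine mem_iUnion.2 ⟨n, hn, ?_⟩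
          by_contra h
          exact hx (mem_iUnion.2 ⟨n, hn, h⟩)
        · exact Or.inl hxY
      · rintro (hx | hx) hxF
        · obtain ⟨n, hn, -⟩ := mem_iUnion.1 hxF
          exact hx (mem_iUnion.2 ⟨n, hn⟩)
        · obtain ⟨n, hn, h1⟩ := mem_iUnion.1 hxF
          obtain ⟨m, hm, h2⟩ := mem_iUnion.1 hx
          rw [hCdj m n x hm hn] at h2
          exact h1 h2
    rw [← isOpen_compl_iff, this]
    exact hY.compl.isOpen.union (isOpen_iUnion fun n => ((hC n).inter (Q D n).1.2.1).isOpen)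
  have hfip : ∀ s : Finset T, ∃ x, ∀ D ∈ s, x ∈ F D := by
    intro s
    obtain ⟨x, hx, hxs⟩ := hlink s.card s rfl 0 (C s.card) (hCne _) (fun D _ => hCA _ _)
    refine ⟨x, fun D hD => mem_iUnion.2 ⟨s.card, hx, ?_⟩⟩
    have := hxs D hD
    rw [Nat.zero_add] at this
    exact this
  obtain ⟨p, -, hp⟩ := (isCompact_univ (X := StoneCech X)).inter_iInter_nonempty
    (fun D : T => closure (stoneCechUnit '' F D)) (fun D => isClosed_closure) (by
      intro s
      obtain ⟨x, hx⟩ := hfip s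
      refine ⟨stoneCechUnit x, trivial, ?_⟩
      simp only [mem_iInter]
      exact fun D hD => subset_closure ⟨x, hx D hD, rfl⟩)
  refine ⟨p, fun D hD hdisc hpD => ?_⟩
  have hpF := mem_iInter.1 hp ⟨D, hD, hdisc⟩
  let D' : T := ⟨D, hD, hdisc⟩
  let f : X → Bool := (F D').boolIndicator
  have hf : Continuous f := (continuous_boolIndicator_iff_isClopen _).2 (hFclopen D')
  have key : ∀ (S : Set X) (b : Bool), (∀ x ∈ S, f x = b) → p ∈ closure (stoneCechUnit '' S) →
      stoneCechExtend hf p = b := by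
    intro S b hS hpS
    have hcl : IsClosed (stoneCechExtend hf ⁻¹' {b}) :=
      (isClosed_discrete {b}).preimage (continuous_stoneCechExtend hf)
    refine closure_minimal ?_ hcl hpS
    rintro _ ⟨x, hx, rfl⟩
    simp only [mem_preimage, mem_singleton_iff, stoneCechExtend_stoneCechUnit]
    exact hS x hx
  have e1 := key (F D') true (fun x hx => (Set.mem_iff_boolIndicator _ _).1 hx) hpF
  have e2 := key D false (fun x hx => (Set.notMem_iff_boolIndicator _ _).1
    (fun h => hFD D' x h hx)) hpD
  rw [e1] at e2
  exact absurd e2 (by decide)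
end

section
/- Assume 𝔭 > ω₁. Let K be a compact Hausdorff space, p ∈ K such that K \ {p} is countably tight, and let A ⊆ K be a countable dense subset with p ∈ cl(A). Then there is a discrete subset D ⊆ A with p ∈ cl(D). -/
open Set Topology

/-- The pseudo-intersection number 𝔭 : the least cardinality of a family of infinite
subsets of ω with the strong finite intersection property and no infinite
pseudo-intersection. -/
noncomputable def pseudoIntersectionNumber : Cardinal :=
  sInf { c | ∃ F : Set (Set ℕ), Cardinal.mk F = c ∧ (∀ A ∈ F, A.Infinite) ∧
    (∀ S : Finset (Set ℕ), ↑S ⊆ F → (⋂₀ (S : Set (Set ℕ))).Infinite) ∧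
    ¬ ∃ B : Set ℕ, B.Infinite ∧ ∀ A ∈ F, (B \ A).Finite }

theorem pseudo_exists (hp : Cardinal.aleph 1 < pseudoIntersectionNumber)
    {α ι : Type} [Countable α] [Infinite α] (hι : Cardinal.mk ι ≤ Cardinal.aleph 1)
    (T : ι → Set α) (hT : ∀ s : Finset ι, (⋂ i ∈ s, T i).Infinite) :
    ∃ B : Set α, B.Infinite ∧ ∀ i, (B \ T i).Finite := by
  classical
  obtain ⟨e⟩ : Nonempty (α ≃ ℕ) := nonempty_equiv_of_countable
  let F : Set (Set ℕ) := Set.range (fun i => e '' T i)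
  have hF : Cardinal.mk F < pseudoIntersectionNumber :=
    (Cardinal.mk_range_le.trans hι).trans_lt hp
  have h1 := notMem_of_lt_csInf' hF
  simp only [Set.mem_ofPred_eq, not_exists, not_and, not_not] at h1
  have hfin : ∀ S : Finset (Set ℕ), ↑S ⊆ F → (⋂₀ (S : Set (Set ℕ))).Infinite := by
    intro S hS
    obtain ⟨s, hs⟩ : ∃ s : Finset ι, s.image (fun i => e '' T i) = S := by
      have := Finset.subset_set_image_iff (s := (Set.univ : Set ι)) (t := S)
        (f := fun i => e '' T i)
      rw [Set.image_univ] at this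
      obtain ⟨s, -, h⟩ := this.1 hS
      exact ⟨s, h⟩
    refine ((hT s).image e.injective.injOn).mono ?_
    rintro _ ⟨x, hx, rfl⟩ t ht
    rw [← hs] at ht
    simp only [Finset.coe_image, Set.mem_image, Finset.mem_coe] at ht
    obtain ⟨i, hi, rfl⟩ := ht
    exact ⟨x, by simpa using Set.mem_iInter₂.1 hx i hi, rfl⟩
  have hinf : ∀ A ∈ F, A.Infinite := by
    intro A hA
    have := hfin {A} (by simpa using hA)
    simpa using this
  obtain ⟨B, hB, hB'⟩ : ∃ B : Set ℕ, B.Infinite ∧ ∀ A ∈ F, (B \ A).Finite := by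
    by_contra hcon
    exact h1 F rfl hinf hfin (fun B hB hB' => hcon ⟨B, hB, hB'⟩)
  refine ⟨e.symm '' B, hB.image e.symm.injective.injOn, fun i => ?_⟩
  have := (hB' (e '' T i) ⟨i, rfl⟩).image e.symm
  refine this.subset ?_
  rintro _ ⟨⟨b, hb, rfl⟩, hn⟩
  refine ⟨b, ⟨hb, ?_⟩, rfl⟩
  rintro ⟨x, hx, rfl⟩
  simp at hn
  exact hn hx

theorem dense_inf {K : Type} [TopologicalSpace K] [T2Space K] {A : Set K} (hd : Dense A)
    {x : K} (hx : x ∉ A) {U : Set K} (hU : IsOpen U) (hxU : x ∈ U) : (U ∩ A).Infinite := by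
  intro hf
  obtain ⟨y, hy, hyA⟩ := hd.inter_open_nonempty (U \ (U ∩ A)) (hU.sdiff hf.isClosed)
    ⟨x, hxU, fun h => hx h.2⟩
  exact hy.2 ⟨hy.1, hyA⟩

theorem seq_exists (hp : Cardinal.aleph 1 < pseudoIntersectionNumber)
    {K : Type} [TopologicalSpace K] [T2Space K] {ι : Type} (hι : Cardinal.mk ι ≤ Cardinal.aleph 1)
    {A : Set K} (hA : A.Countable) (hd : Dense A) (h : ι → C(K, ℝ)) (x : K) (hx : x ∉ A)
    (hh : ∀ i, h i x = 0) :
    ∃ B ⊆ A, B.Infinite ∧ ∀ i, ∀ ε > 0, {a ∈ B | ε ≤ |h i a|}.Finite := by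
  classical
  have : Countable A := hA
  have : Infinite A := by
    have := dense_inf hd hx isOpen_univ (mem_univ x)
    rw [univ_inter] at this
    exact this.to_subtype
  have hc : Cardinal.mk (ι × ℕ) ≤ Cardinal.aleph 1 := by
    rw [Cardinal.mk_prod]
    simp only [Cardinal.lift_id, Cardinal.mk_nat, Cardinal.lift_aleph0]
    exact Cardinal.mul_le_of_le (Cardinal.aleph0_le_aleph 1) hι (Cardinal.aleph0_le_aleph 1)
  obtain ⟨B, hB, hB'⟩ := pseudo_exists hp (α := A) hc
    (fun q => {a : A | |h q.1 a| < 1 / ((q.2 : ℝ) + 1)}) (by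
      intro s
      have ho : IsOpen (⋂ q ∈ s, {a : K | |h q.1 a| < 1 / ((q.2 : ℝ) + 1)}) := by
        refine isOpen_biInter_finset fun q _ => ?_
        exact isOpen_lt (by fun_prop) continuous_const
      have := dense_inf hd hx ho (by
        simp only [mem_iInter, mem_ofPred_eq, hh, abs_zero]
        intro q _
        positivity)
      intro hf
      refine this ((hf.image Subtype.val).subset ?_)
      rintro y ⟨hy, hyA⟩
      refine ⟨⟨y, hyA⟩, ?_, rfl⟩
      simpa using hy)
  refine ⟨Subtype.val '' B, by simp, hB.image Subtype.val_injective.injOn, fun i ε hε => ?_⟩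
  obtain ⟨n, hn⟩ := exists_nat_one_div_lt hε
  refine ((hB' (i, n)).image Subtype.val).subset ?_
  rintro _ ⟨⟨b, hb, rfl⟩, hε'⟩
  refine ⟨b, ⟨hb, ?_⟩, rfl⟩
  simp only [mem_ofPred_eq, not_lt]
  exact hn.le.trans hε'

theorem union_exists (hp : Cardinal.aleph 1 < pseudoIntersectionNumber)
    {K : Type} {ι : Type} (hι : Cardinal.mk ι ≤ Cardinal.aleph 1)
    {A : Set K} (hA : A.Countable) (g : K → ℝ) (hg : ∀ a ∈ A, 0 < g a)
    (B : ι → Set K) (hBA : ∀ i, B i ⊆ A) (hBi : ∀ i, (B i).Infinite)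
    (hB : ∀ i, ∀ ε > 0, {a ∈ B i | ε ≤ g a}.Finite) :
    ∃ D ⊆ A, (∀ ε > 0, {a ∈ D | ε ≤ g a}.Finite) ∧ ∀ i, (D ∩ B i).Infinite := by
  classical
  obtain ⟨e, he⟩ := Set.countable_iff_exists_injOn.1 hA
  let Dn : ℕ × ℕ → Set K := fun q => {a ∈ A | e a ≤ q.2 ∧ g a < 1 / ((q.1 : ℝ) + 1)}
  have hDfin : ∀ q, (Dn q).Finite := by
    intro q
    refine Set.Finite.of_finite_image ((Set.finite_Iic q.2).subset ?_)
      (he.mono fun a ha => ha.1)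
    rintro _ ⟨a, ha, rfl⟩
    exact ha.2.1
  have hc : Cardinal.mk (ι ⊕ ℕ) ≤ Cardinal.aleph 1 := by
    simp only [Cardinal.mk_sum, Cardinal.lift_id, Cardinal.mk_nat, Cardinal.lift_aleph0]
    exact Cardinal.add_le_of_le (Cardinal.aleph0_le_aleph 1) hι (Cardinal.aleph0_le_aleph 1)
  have hne : ∀ i n, ∃ k, ∀ k' ≥ k, (Dn (n, k') ∩ B i).Nonempty := by
    intro i n
    have h1 : (B i \ {a ∈ B i | 1 / ((n : ℝ) + 1) ≤ g a}).Infinite :=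
      (hBi i).sdiff (hB i _ (by positivity))
    obtain ⟨a, ha, ha'⟩ := h1.nonempty
    refine ⟨e a, fun k' hk => ⟨a, ⟨hBA i ha, hk, ?_⟩, ha⟩⟩
    by_contra hcon
    exact ha' ⟨ha, not_lt.1 hcon⟩
  choose k hk using hne
  obtain ⟨S, hS, hS'⟩ := pseudo_exists hp (α := ℕ × ℕ) hc
    (fun j => Sum.elim (fun i => {q : ℕ × ℕ | (Dn q ∩ B i).Nonempty})
      (fun m => {q | m ≤ q.1}) j) (by
      intro s
      obtain ⟨N, hN⟩ : ∃ N : ℕ, ∀ m, Sum.inr m ∈ s → m ≤ N := by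
        refine ⟨s.sup (Sum.elim (fun _ => 0) id), fun m hm => ?_⟩
        exact Finset.le_sup (f := (Sum.elim (fun _ => 0) id : ι ⊕ ℕ → ℕ)) hm
      obtain ⟨M, hM⟩ : ∃ M : ℕ, ∀ i, Sum.inl i ∈ s → k i N ≤ M := by
        refine ⟨s.sup (Sum.elim (fun i => k i N) id), fun m hm => ?_⟩
        exact Finset.le_sup (f := (Sum.elim (fun i => k i N) id : ι ⊕ ℕ → ℕ)) hm
      have : ((fun l : ℕ => (N, M + l)) '' univ).Infinite :=
        Set.infinite_univ.image (fun a _ b _ h => by simpa using h)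
      refine this.mono ?_
      rintro _ ⟨l, -, rfl⟩
      simp only [mem_iInter]
      rintro (i | m) hj
      · exact hk i N _ ((hM i hj).trans (Nat.le_add_right _ _))
      · exact hN m hj)
  refine ⟨⋃ q ∈ S, Dn q, ?_, ?_, ?_⟩
  · intro a ha
    simp only [mem_iUnion] at ha
    obtain ⟨q, -, hq⟩ := ha
    exact hq.1
  · intro ε hε
    obtain ⟨n, hn⟩ := exists_nat_one_div_lt hε
    refine ((hS' (Sum.inr n)).biUnion (fun q _ => hDfin q)).subset ?_
    rintro a ⟨ha, haε⟩
    simp only [mem_iUnion] at ha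
    obtain ⟨q, hqS, hq⟩ := ha
    simp only [mem_iUnion]
    refine ⟨q, ⟨hqS, ?_⟩, hq⟩
    simp only [Sum.elim_inr, mem_ofPred_eq, not_le]
    by_contra hcon
    have h2 : (1 : ℝ) / ((q.1 : ℝ) + 1) ≤ 1 / ((n : ℝ) + 1) := by
      have : (n : ℝ) ≤ q.1 := by exact_mod_cast not_lt.1 hcon
      gcongr
    have := hq.2.2
    linarith
  · intro i hfin
    -- a positive lower bound for `g` on the finite set
    obtain ⟨n, hn⟩ : ∃ n : ℕ, ∀ a ∈ (⋃ q ∈ S, Dn q) ∩ B i, 1 / ((n : ℝ) + 1) ≤ g a := by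
      have h3 : ∀ a, ∃ n : ℕ, a ∈ A → 1 / ((n : ℝ) + 1) ≤ g a := by
        intro a
        by_cases ha : a ∈ A
        · obtain ⟨n, hn⟩ := exists_nat_one_div_lt (hg a ha)
          exact ⟨n, fun _ => hn.le⟩
        · exact ⟨0, fun h => absurd h ha⟩
      choose u hu using h3
      obtain ⟨N, hN⟩ := (hfin.image u).bddAbove
      refine ⟨N, fun a ha => le_trans ?_ (hu a (hBA i ha.2))⟩
      have : (u a : ℝ) ≤ N := by exact_mod_cast hN ⟨a, ha, rfl⟩
      gcongr
    obtain ⟨q, hq⟩ := ((hS.sdiff (hS' (Sum.inl i))).sdiff (hS' (Sum.inr n))).nonempty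
    simp only [Sum.elim_inr, Sum.elim_inl, mem_sdiff, mem_ofPred_eq, not_and, not_not] at hq
    obtain ⟨⟨h1, h2⟩, h3⟩ := hq
    obtain ⟨a, ha, haB⟩ := h2 h1
    have h4 := hn a ⟨mem_iUnion₂.2 ⟨q, h1, ha⟩, haB⟩
    have h5 : (1 : ℝ) / ((q.1 : ℝ) + 1) ≤ 1 / ((n : ℝ) + 1) := by
      have : (n : ℝ) ≤ q.1 := by exact_mod_cast h3 h1
      gcongr
    have := ha.2.2
    linarith

theorem good_family (hp : Cardinal.aleph 1 < pseudoIntersectionNumber)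
    {K : Type} [TopologicalSpace K] [CompactSpace K] [T2Space K] (p : K)
    {A : Set K} (hA : A.Countable) (hd : Dense A) (g : C(K, ℝ)) (hg : ∀ a ∈ A, 0 < g a)
    {J ι : Type} (hJ : Cardinal.mk J ≤ Cardinal.aleph 1) (hι : Cardinal.mk ι ≤ Cardinal.aleph 1)
    (h : J → ι → C(K, ℝ))
    (hne : ∀ j, ∃ x, g x = 0 ∧ ∀ i, h j i x = 0)
    (hpc : ∀ z : J → K, (∀ j, g (z j) = 0) → (∀ j i, h j i (z j) = 0) → p ∈ closure (range z)) :
    ∃ D ⊆ A, IsDiscreteSubset D ∧ p ∈ closure D := by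
  have hc : Cardinal.mk (Option ι) ≤ Cardinal.aleph 1 := by
    rw [Cardinal.mk_option]
    exact Cardinal.add_le_of_le (Cardinal.aleph0_le_aleph 1) hι
      (Cardinal.one_le_aleph0.trans (Cardinal.aleph0_le_aleph 1))
  have h1 : ∀ j, ∃ B ⊆ A, B.Infinite ∧ ∀ i : Option ι, ∀ ε > 0,
      {a ∈ B | ε ≤ |(i.elim g (h j) : C(K, ℝ)) a|}.Finite := by
    intro j
    obtain ⟨x, hx, hx'⟩ := hne j
    refine seq_exists hp hc hA hd _ x (fun hxA => (hg x hxA).ne' hx) ?_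
    rintro (_ | i)
    · exact hx
    · exact hx' i
  choose B hBA hBi hB using h1
  obtain ⟨D, hDA, hDg, hDB⟩ := union_exists hp hJ hA g hg B hBA hBi (by
    intro j ε hε
    refine (hB j none ε hε).subset ?_
    rintro a ⟨ha, ha'⟩
    exact ⟨ha, ha'.trans (le_abs_self _)⟩)
  refine ⟨D, hDA, ?_, ?_⟩
  · intro x hx
    have hgx := hg x (hDA hx)
    have hf := hDg (g x / 2) (by positivity)
    refine ⟨{y | g x / 2 < g y} \ ({a ∈ D | g x / 2 ≤ g a} \ {x}),
      (isOpen_lt continuous_const g.continuous).sdiff (hf.subset sdiff_subset).isClosed,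
      ⟨by simp only [mem_ofPred_eq]; linarith, by simp⟩, ?_⟩
    ext y
    simp only [mem_inter_iff, mem_sdiff, mem_ofPred_eq, mem_singleton_iff]
    constructor
    · rintro ⟨⟨h1, h2⟩, h3⟩
      by_contra hcon
      exact h2 ⟨⟨h3, h1.le⟩, hcon⟩
    · rintro rfl
      exact ⟨⟨by linarith, by simp⟩, hx⟩
  · have hz : ∀ j, ∃ z ∈ closure D, ∀ i : Option ι, (i.elim g (h j) : C(K, ℝ)) z = 0 := by
      intro j
      obtain ⟨z, hz⟩ := (hDB j).exists_accPt_principal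
      rw [accPt_iff_frequently] at hz
      refine ⟨z, ?_, fun i => ?_⟩
      · rw [mem_closure_iff_frequently]
        exact hz.mono fun y hy => hy.2.1
      · by_contra hcon
        set φ : C(K, ℝ) := i.elim g (h j) with hφ
        have hpos : 0 < |φ z| := abs_pos.2 hcon
        have hfin := hB j i (|φ z| / 2) (by positivity)
        have hev : ∀ᶠ y in 𝓝 z, |φ z| / 2 < |φ y| :=
          (isOpen_lt continuous_const (by fun_prop)).mem_nhds
            (show |φ z| / 2 < |φ z| by linarith)
        have hev2 : ∀ᶠ y in 𝓝 z, y ∉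
            ({a ∈ B j | |φ z| / 2 ≤ |φ a|} \ {z}) :=
          (Set.Finite.isClosed (hfin.subset sdiff_subset)).isOpen_compl.mem_nhds (by simp)
        obtain ⟨y, ⟨hy1, hy2⟩, hy3, hy4⟩ := (hz.and_eventually (hev.and hev2)).exists
        exact hy4 ⟨⟨hy2.2, hy3.le⟩, hy1⟩
    choose z hz hz' using hz
    exact closure_minimal (range_subset_iff.2 hz) isClosed_closure (hpc z (fun j => hz' j none) (fun j i => hz' j (some i)))

theorem rec_exists {I X : Type} [LinearOrder I] [WellFoundedLT I] [Nonempty X]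
    (R : ∀ α : I, (∀ γ, γ < α → X) → X → Prop) :
    ∃ f : I → X, ∀ α, (∃ φ, R α (fun γ _ => f γ) φ) → R α (fun γ _ => f γ) (f α) := by
  classical
  let F : ∀ α : I, (∀ γ, γ < α → X) → X := fun α prev => Classical.epsilon (R α prev)
  let f : I → X := (wellFounded_lt (α := I)).fix F
  refine ⟨f, fun α h => ?_⟩
  have : f α = F α (fun γ _ => f γ) := WellFounded.fix_eq _ _ _
  rw [this]
  exact Classical.epsilon_spec h

theorem countable_bdd {C : Set (Cardinal.aleph 1).ord.ToType} (hC : C.Countable) :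
    ∃ γ, ∀ β ∈ C, β < γ := by
  rw [← not_isCofinal_iff]
  intro h
  have h1 := Order.cof_le h
  rw [Ordinal.cof_toType, Cardinal.isRegular_aleph_one.cof_ord] at h1
  have h2 := h1.trans hC.le_aleph0
  exact absurd h2 (not_le.2 Cardinal.aleph0_lt_aleph_one)

theorem exists_g {K : Type} [TopologicalSpace K] [CompactSpace K] [T2Space K] (p : K)
    (A : Set K) (hA : A.Countable) (hpA : p ∉ A) :
    ∃ g : C(K, ℝ), g p = 0 ∧ ∀ a ∈ A, 0 < g a := by
  classical
  rcases A.eq_empty_or_nonempty with rfl | hne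
  · exact ⟨0, rfl, by simp⟩
  obtain ⟨u, rfl⟩ := hA.exists_eq_range hne
  have h1 : ∀ n, ∃ f : C(K, ℝ), f p = 0 ∧ f (u n) = 1 ∧ ∀ x, f x ∈ Icc (0 : ℝ) 1 := by
    intro n
    obtain ⟨f, hf, hf', hf''⟩ := exists_continuous_zero_one_of_isClosed
      (isClosed_singleton (x := p)) (isClosed_singleton (x := u n))
      (by simp only [disjoint_singleton]; rintro rfl; exact hpA ⟨n, rfl⟩)
    exact ⟨f, hf rfl, hf' rfl, hf''⟩
  choose f hf0 hf1 hf using h1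
  have hb : ∀ n x, ‖(1 / 2 : ℝ) ^ n * f n x‖ ≤ (1 / 2 : ℝ) ^ n := by
    intro n x
    rw [norm_mul, norm_pow, Real.norm_of_nonneg (hf n x).1]
    have := (hf n x).2
    rw [Real.norm_of_nonneg (by norm_num : (0 : ℝ) ≤ 1 / 2)]
    exact mul_le_of_le_one_right (by positivity) this
  have hs : Summable fun n : ℕ => (1 / 2 : ℝ) ^ n := summable_geometric_two
  refine ⟨⟨fun x => ∑' n, (1 / 2 : ℝ) ^ n * f n x,
    continuous_tsum (fun n => by fun_prop) hs hb⟩, by simp [hf0], ?_⟩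
  rintro _ ⟨n, rfl⟩
  refine Summable.tsum_pos (Summable.of_norm_bounded hs fun m => hb m (u n))
    (fun m => mul_nonneg (by positivity) (hf m _).1) n ?_
  simp [hf1]

/-- Assume 𝔭 > ω₁. If `K` is compact Hausdorff, `p ∈ K`, `K \ {p}` is countably tight
and `A ⊆ K` is a countable dense subset, then some discrete `D ⊆ A` has `p` in its
closure. -/
theorem statement19 (hp : Cardinal.aleph 1 < pseudoIntersectionNumber)
    {K : Type} [TopologicalSpace K] [CompactSpace K] [T2Space K] (p : K)
    (hct : CountablyTight ↥({p}ᶜ : Set K))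
    (A : Set K) (hA : A.Countable) (hdense : Dense A) :
    ∃ D ⊆ A, IsDiscreteSubset D ∧ p ∈ closure D := by
  classical
  by_cases hpA : p ∈ A
  · refine ⟨{p}, by simpa using hpA, ?_, subset_closure rfl⟩
    rintro x rfl
    exact ⟨univ, isOpen_univ, mem_univ _, by simp⟩
  obtain ⟨g, hgp, hg⟩ := exists_g p A hA hpA
  let I := (Cardinal.aleph 1).ord.ToType
  have hI : Cardinal.mk I ≤ Cardinal.aleph 1 := by simp [I]
  have hnm : NoMaxOrder I := Cardinal.noMaxOrder (Cardinal.aleph0_le_aleph 1)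
  have hIne : Nonempty I := by
    obtain ⟨γ, -⟩ := countable_bdd (C := ∅) countable_empty
    exact ⟨γ⟩
  obtain ⟨f, hf⟩ := rec_exists (I := I) (X := C(K, ℝ)) (fun α prev φ =>
    φ p = 0 ∧ ∀ β ≤ α, ∃ x, g x = 0 ∧
      (∀ γ (h : γ < α), (γ < β → prev γ h x = 0) ∧ (β ≤ γ → prev γ h x = 1)) ∧ φ x = 1)
  let Good : I → C(K, ℝ) → Prop := fun α φ => φ p = 0 ∧ ∀ β ≤ α, ∃ x, g x = 0 ∧
      (∀ γ, γ < α → (γ < β → f γ x = 0) ∧ (β ≤ γ → f γ x = 1)) ∧ φ x = 1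
  have hf' : ∀ α, (∃ φ, Good α φ) → Good α (f α) := hf
  -- nonemptiness
  have hne : ∀ (S : Set I), IsLowerSet S → (∀ γ ∈ S, Good γ (f γ)) → ∀ β ∈ S,
      ∃ x, g x = 0 ∧ ∀ γ ∈ S, (γ < β → f γ x = 0) ∧ (β ≤ γ → f γ x = 1) := by
    intro S hS hgood β hβ
    let t : {γ : I // γ ∈ S ∧ β ≤ γ} → Set K := fun γ =>
      {x | g x = 0 ∧ ∀ δ ≤ γ.1, (δ < β → f δ x = 0) ∧ (β ≤ δ → f δ x = 1)}
    have hcl : ∀ γ, IsClosed (t γ) := by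
      intro γ
      have : t γ = {x | g x = 0} ∩ ⋂ δ ≤ γ.1, ({x | δ < β → f δ x = 0} ∩
          {x | β ≤ δ → f δ x = 1}) := by
        ext x
        simp [t]
      rw [this]
      refine (isClosed_eq g.continuous continuous_const).inter
        (isClosed_biInter fun δ _ => IsClosed.inter ?_ ?_)
      · by_cases h : δ < β
        · simpa [h] using isClosed_eq (f δ).continuous continuous_const
        · simp [h]
      · by_cases h : β ≤ δ
        · simpa [h] using isClosed_eq (f δ).continuous continuous_const
        · simp [h]
    have hanti : ∀ γ δ, γ.1 ≤ δ.1 → t δ ⊆ t γ := fun γ δ h x hx =>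
      ⟨hx.1, fun ε hε => hx.2 ε (hε.trans h)⟩
    haveI : Nonempty {γ : I // γ ∈ S ∧ β ≤ γ} := ⟨⟨β, hβ, le_rfl⟩⟩
    obtain ⟨x, hx⟩ := IsCompact.nonempty_iInter_of_directed_nonempty_isCompact_isClosed t
      (by
        intro γ δ
        rcases le_total γ.1 δ.1 with h | h
        · exact ⟨δ, hanti _ _ h, subset_rfl⟩
        · exact ⟨γ, subset_rfl, hanti _ _ h⟩)
      (by
        rintro ⟨γ, hγ, hβγ⟩
        obtain ⟨x, hx1, hx2, hx3⟩ := (hgood γ hγ).2 β hβγ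
        refine ⟨x, hx1, fun δ hδ => ?_⟩
        rcases hδ.lt_or_eq with h | h
        · exact hx2 δ h
        · subst h
          exact ⟨fun h' => absurd h' (not_lt.2 hβγ), fun _ => hx3⟩)
      (fun γ => (hcl γ).isCompact) hcl
    rw [mem_iInter] at hx
    refine ⟨x, (hx ⟨β, hβ, le_rfl⟩).1, fun γ hγ => ?_⟩
    rcases le_total β γ with h | h
    · exact (hx ⟨γ, hγ, h⟩).2 γ le_rfl
    · exact (hx ⟨β, hβ, le_rfl⟩).2 γ h
  let H : Set I → I → I → C(K, ℝ) := fun S β γ =>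
    if γ ∈ S then (if γ < β then f γ else f γ - 1) else 0
  have hH : ∀ S β x, (∀ γ, H S β γ x = 0) ↔
      ∀ γ ∈ S, (γ < β → f γ x = 0) ∧ (β ≤ γ → f γ x = 1) := by
    intro S β x
    refine forall_congr' fun γ => ?_
    by_cases h1 : γ ∈ S
    · by_cases h2 : γ < β
      · simp [H, h1, h2]
      · simp [H, h1, h2, not_lt.1 h2, sub_eq_zero]
    · simp [H, h1]
  by_cases hall : ∀ α, Good α (f α)
  · refine good_family hp p hA hdense g hg hI hI (H univ) ?_ ?_
    · intro β
      obtain ⟨x, hx, hx'⟩ := hne univ isLowerSet_univ (fun γ _ => hall γ) β (mem_univ _)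
      exact ⟨x, hx, (hH _ _ _).2 hx'⟩
    · intro z _ hz
      have hz' : ∀ β γ, (γ < β → f γ (z β) = 0) ∧ (β ≤ γ → f γ (z β) = 1) :=
        fun β γ => (hH univ β (z β)).1 (hz β) γ (mem_univ _)
      by_contra hcon
      obtain ⟨q, hq⟩ := exists_clusterPt_of_compactSpace (Filter.map z Filter.atTop)
      have hqr : q ∈ closure (range z) := by
        rw [mem_closure_iff_clusterPt]
        refine hq.mono ?_
        rw [Filter.le_principal_iff]
        exact Filter.range_mem_map
      have hqp : q ≠ p := by
        rintro rfl
        exact hcon hqr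
      have hq0 : ∀ γ, f γ q = 0 := by
        intro γ
        have hc : IsClosed {x | f γ x = 0} := isClosed_eq (f γ).continuous continuous_const
        have : q ∈ closure {x | f γ x = 0} := by
          rw [mem_closure_iff_clusterPt]
          refine hq.mono ?_
          rw [Filter.le_principal_iff, Filter.mem_map]
          filter_upwards [Filter.eventually_gt_atTop γ] with β hβ
          exact (hz' β γ).1 hβ
        rwa [hc.closure_eq] at this
      have hzp : ∀ β, z β ≠ p := by
        rintro β rfl
        exact hcon (subset_closure ⟨β, rfl⟩)
      let z' : I → ({p}ᶜ : Set K) := fun β => ⟨z β, hzp β⟩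
      have hq' : (⟨q, hqp⟩ : ({p}ᶜ : Set K)) ∈ closure (range z') := by
        rw [closure_subtype]
        rwa [← range_comp]
      obtain ⟨C, hC, hCc, hqC⟩ := hct _ _ hq'
      have hch : ∀ c : C, ∃ β, z' β = c := fun c => hC c.2
      choose b hb using hch
      haveI : Countable C := hCc
      obtain ⟨γ, hγ⟩ := countable_bdd (countable_range b)
      rw [closure_subtype] at hqC
      have hc : IsClosed {x | f γ x = 1} := isClosed_eq (f γ).continuous continuous_const
      have h1 : q ∈ {x | f γ x = 1} := by
        refine closure_minimal ?_ hc hqC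
        rintro _ ⟨c, hc, rfl⟩
        have h2 := (hz' (b ⟨c, hc⟩) γ).2 (hγ _ ⟨_, rfl⟩).le
        have h3 : z (b ⟨c, hc⟩) = c := congrArg Subtype.val (hb ⟨c, hc⟩)
        rwa [h3] at h2
      have h0 := hq0 γ
      rw [mem_ofPred_eq, h0] at h1
      exact zero_ne_one h1
  · rw [not_forall] at hall
    obtain ⟨α, hα, hmin⟩ := WellFounded.has_min (wellFounded_lt (α := I))
      {α | ¬ Good α (f α)} hall
    have hbelow : ∀ γ < α, Good γ (f γ) := by
      intro γ hγ
      by_contra h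
      exact hmin γ h hγ
    refine good_family hp p hA hdense g hg (J := Iic α) ((Cardinal.mk_set_le _).trans hI) hI
      (fun β => H (Iio α) β) ?_ ?_
    · rintro ⟨β, hβ⟩
      rcases (mem_Iic.1 hβ).lt_or_eq with h | h
      · obtain ⟨x, hx, hx'⟩ := hne (Iio α) (isLowerSet_Iio α) hbelow β h
        exact ⟨x, hx, (hH _ _ _).2 hx'⟩
      · subst h
        refine ⟨p, hgp, (hH _ _ _).2 fun γ hγ => ⟨fun _ => (hbelow γ hγ).1, fun h => ?_⟩⟩
        exact absurd h (not_le.2 hγ)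
    · intro z hzg hz
      by_contra hcon
      obtain ⟨φ, h0, h1, -⟩ := exists_continuous_zero_one_of_isClosed
        (isClosed_singleton (x := p)) (isClosed_closure (s := range z))
        (by simpa using hcon)
      refine hα (hf' α ⟨φ, h0 rfl, fun β hβ => ⟨z ⟨β, hβ⟩, hzg _, ?_, ?_⟩⟩)
      · exact (hH (Iio α) β (z ⟨β, hβ⟩)).1 (hz ⟨β, hβ⟩)
      · exact h1 (subset_closure ⟨_, rfl⟩)
end
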